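/- arXiv:2505.03243 — 2 statements merged into one kernel-verified Lean document; each statement's English description precedes it below -/
import Mathlib

section
/- (Property GR3) Let (P, ≤) be a partially ordered set and l : P → ℕ a strictly monotone function, with Gabriel–Roiter measure l*. Let x, y ∈ P with l(y) ≤ l(x). If l*(x') < l*(y) in the lexicographical order for every x' ∈ P with x' < x, then l*(x) ≤ l*(y). -/
/-- The lexicographical order on finite subsets of `ℕ`: `X ≤ Y` iff
`min (Y \ X) ≤ min (X \ Y)`, where the minimum of the empty set is `+∞`. -/
def lexLe (X Y : Finset ℕ) : Prop := (Y \ X).min ≤ (X \ Y).min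

/-- The strict lexicographical order on finite subsets of `ℕ`. -/
def lexLt (X Y : Finset ℕ) : Prop := lexLe X Y ∧ X ≠ Y

/-- A (finite) chain in a poset `P` ending at `x`: a finite subset of `P` that is totally
ordered by `≤` and has greatest element `x`. -/
def IsChainEnding {P : Type*} [PartialOrder P] (C : Finset P) (x : P) : Prop :=
  x ∈ C ∧ (∀ a ∈ C, a ≤ x) ∧ ∀ a ∈ C, ∀ b ∈ C, a ≤ b ∨ b ≤ a

/-- `S` is the Gabriel–Roiter measure `l*(x)` of `x` with respect to `l`: `S` is the image
`l C₀` of some chain `C₀` ending at `x`, and is lexicographically greatest among the images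
of chains ending at `x`. -/
def IsGRMeasureAt {P : Type*} [PartialOrder P] (l : P → ℕ) (x : P) (S : Finset ℕ) : Prop :=
  (∃ C : Finset P, IsChainEnding C x ∧ C.image l = S) ∧
  ∀ C : Finset P, IsChainEnding C x → lexLe (C.image l) S

theorem lexLe_iff {X Y : Finset ℕ} :
    lexLe X Y ↔ ∀ a ∈ X, a ∉ Y → ∃ b ∈ Y, b ∉ X ∧ b ≤ a := by
  unfold lexLe
  constructor
  · intro h a ha haY
    have hle : (Y \ X).min ≤ a := h.trans (Finset.min_le (Finset.mem_sdiff.2 ⟨ha, haY⟩))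
    obtain ⟨b, hb⟩ := WithTop.ne_top_iff_exists.1 (ne_top_of_le_ne_top WithTop.coe_ne_top hle)
    have hmem := Finset.mem_sdiff.1 (Finset.mem_of_min hb.symm)
    rw [← hb] at hle
    exact ⟨b, hmem.1, hmem.2, WithTop.coe_le_coe.1 hle⟩
  · intro h
    refine Finset.le_min fun a ha => ?_
    obtain ⟨haX, haY⟩ := Finset.mem_sdiff.1 ha
    obtain ⟨b, hbY, hbX, hba⟩ := h a haX haY
    exact (Finset.min_le (Finset.mem_sdiff.2 ⟨hbY, hbX⟩)).trans (WithTop.coe_le_coe.2 hba)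

/-- The lexicographical order is the colexicographical order for the reversed order on `ℕ`. -/
theorem lexLe_iff_toColex_le {X Y : Finset ℕ} :
    lexLe X Y ↔ toColex (α := Finset ℕᵒᵈ) X ≤ toColex (α := Finset ℕᵒᵈ) Y :=
  lexLe_iff

theorem lexLe_trans {X Y Z : Finset ℕ} (hXY : lexLe X Y) (hYZ : lexLe Y Z) : lexLe X Z := by
  rw [lexLe_iff_toColex_le] at *
  exact hXY.trans hYZ

theorem lexLe_antisymm {X Y : Finset ℕ} (hXY : lexLe X Y) (hYX : lexLe Y X) : X = Y := by
  rw [lexLe_iff_toColex_le] at *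
  exact toColex_inj.1 (hXY.antisymm hYX)

theorem lexLt_of_lexLe_of_lexLt {X Y Z : Finset ℕ} (hXY : lexLe X Y) (hYZ : lexLt Y Z) :
    lexLt X Z := by
  refine ⟨lexLe_trans hXY hYZ.1, ?_⟩
  rintro rfl
  exact hYZ.2 (lexLe_antisymm hYZ.1 hXY)

theorem IsChainEnding.singleton {P : Type*} [PartialOrder P] (x : P) :
    IsChainEnding {x} x := by
  simp [IsChainEnding]

/-- Every element of a poset has a Gabriel–Roiter measure with respect to a
strictly monotone function. -/
theorem exists_isGRMeasureAt {P : Type*} [PartialOrder P] {l : P → ℕ} (hl : StrictMono l)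
    (x : P) : ∃ S, IsGRMeasureAt l x S := by
  let A : Set (Finset ℕ) := {S | ∃ C : Finset P, IsChainEnding C x ∧ C.image l = S}
  have hfin : A.Finite := by
    refine (Finset.finite_toSet (Finset.range (l x + 1)).powerset).subset ?_
    rintro _ ⟨C, hC, rfl⟩
    refine Finset.mem_coe.2 (Finset.mem_powerset.2 fun n hn => ?_)
    obtain ⟨a, ha, rfl⟩ := Finset.mem_image.1 hn
    exact Finset.mem_range.2 (Nat.lt_succ_of_le (hl.monotone (hC.2.1 a ha)))
  obtain ⟨S, hSA, hS⟩ := hfin.exists_maximalFor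
    (fun S => toColex (α := Finset ℕᵒᵈ) S) _ ⟨_, {x}, IsChainEnding.singleton x, rfl⟩
  refine ⟨S, hSA, fun C hC => lexLe_iff_toColex_le.2 ?_⟩
  exact (le_total _ _).elim id (hS ⟨C, hC, rfl⟩)

/-- A strict lexicographical inequality is weakly preserved by adding to the smaller set an
upper bound of both sets that is a strict upper bound of the smaller one. -/
theorem lexLe_insert_of_lexLt {R T : Finset ℕ} {n : ℕ} (h : lexLt R T)
    (hR : ∀ a ∈ R, a < n) (hT : ∀ a ∈ T, a ≤ n) : lexLe (insert n R) T := by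
  have hle := lexLe_iff.1 h.1
  have hex : ∃ b ∈ T, b ∉ R := by
    by_contra! hTR
    refine h.2 (Finset.Subset.antisymm (fun a ha => ?_) hTR)
    by_contra haT
    obtain ⟨b, hbT, hbR, -⟩ := hle a ha haT
    exact hbR (hTR b hbT)
  rw [lexLe_iff]
  intro a ha haT
  rcases Finset.mem_insert.1 ha with rfl | haR
  · obtain ⟨b, hbT, hbR⟩ := hex
    refine ⟨b, hbT, fun hb => ?_, hT b hbT⟩
    rcases Finset.mem_insert.1 hb with rfl | hb
    exacts [haT hbT, hbR hb]
  · obtain ⟨b, hbT, hbR, hba⟩ := hle a haR haT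
    refine ⟨b, hbT, fun hb => ?_, hba⟩
    rcases Finset.mem_insert.1 hb with rfl | hb
    exacts [(hR a haR).not_ge hba, hbR hb]

/-- (GR3) Let `x, y ∈ P` with `l y ≤ l x`. If `l*(x') < l*(y)` for every `x' < x`,
then `l*(x) ≤ l*(y)`. -/
theorem grMeasure_GR3 {P : Type*} [PartialOrder P] (l : P → ℕ)
    (hl : ∀ a b : P, a < b → l a < l b) (x y : P) (hxy : l y ≤ l x)
    (S T : Finset ℕ) (hS : IsGRMeasureAt l x S) (hT : IsGRMeasureAt l y T)
    (h : ∀ x' : P, x' < x → ∀ S' : Finset ℕ, IsGRMeasureAt l x' S' → lexLt S' T) :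
    lexLe S T := by
  classical
  have hl' : StrictMono l := fun a b => hl a b
  obtain ⟨⟨C, ⟨hxC, hCx, hC⟩, rfl⟩, -⟩ := hS
  obtain ⟨⟨D, ⟨hyD, hDy, -⟩, rfl⟩, -⟩ := hT
  have hlt : ∀ a ∈ C.erase x, a < x := fun a ha =>
    lt_of_le_of_ne (hCx a (Finset.mem_of_mem_erase ha)) (Finset.ne_of_mem_erase ha)
  rw [← Finset.insert_erase hxC, Finset.image_insert]
  refine lexLe_insert_of_lexLt ?_ ?_ ?_
  · rcases (C.erase x).eq_empty_or_nonempty with he | hne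
    · rw [he, Finset.image_empty]
      exact ⟨lexLe_iff.2 (by simp),
        (Finset.Nonempty.ne_empty ⟨l y, Finset.mem_image_of_mem l hyD⟩).symm⟩
    · obtain ⟨x', hx', hmax⟩ := (C.erase x).exists_max_image l hne
      obtain ⟨S', hS'⟩ := exists_isGRMeasureAt hl' x'
      have hchain : ∀ a ∈ C.erase x, ∀ b ∈ C.erase x, a ≤ b ∨ b ≤ a := fun a ha b hb =>
        hC a (Finset.mem_of_mem_erase ha) b (Finset.mem_of_mem_erase hb)
      refine lexLt_of_lexLe_of_lexLt (hS'.2 _ ⟨hx', fun a ha => ?_, hchain⟩)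
        (h x' (hlt x' hx') S' hS')
      rcases hchain a ha x' hx' with hle | hle
      · exact hle
      · rcases hle.eq_or_lt with heq | hlt'
        · exact heq.ge
        · exact absurd (hl' hlt') (hmax a ha).not_gt
  · intro n hn
    obtain ⟨a, ha, rfl⟩ := Finset.mem_image.1 hn
    exact hl' (hlt a ha)
  · intro n hn
    obtain ⟨a, ha, rfl⟩ := Finset.mem_image.1 hn
    exact (hl'.monotone (hDy a ha)).trans hxy
end

section
/- (Main property of the Gabriel–Roiter measure, first part) Let X, Y₁, …, Yₙ be indecomposable finite-dimensional Λ-modules, and let m be an index with μ(Y_m) = max{μ(Y_i) : 1 ≤ i ≤ n} in the lexicographical order. If there exists an injective Λ-module homomorphism f : X → Y₁ ⊕ ⋯ ⊕ Yₙ, then μ(X) ≤ μ(Y_m). -/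
noncomputable section

/-- A module `M` is indecomposable if `M ≠ 0` and `M` is not the direct sum of two
nonzero submodules. -/
def IsIndecomposableModule (Λ : Type*) [Ring Λ] (M : Type*) [AddCommGroup M]
    [Module Λ M] : Prop :=
  Nontrivial M ∧ ∀ N₁ N₂ : Submodule Λ M, IsCompl N₁ N₂ → N₁ = ⊥ ∨ N₂ = ⊥

open Classical in
/-- The composition length `ℓ(M)` of a module `M`: the length of a composition series of
submodules from `⊥` to `⊤` (well defined by the Jordan–Hölder theorem; junk value `0` if
no composition series exists). -/
def compLength (Λ : Type*) [Ring Λ] (M : Type*) [AddCommGroup M] [Module Λ M] : ℕ :=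
  if h : ∃ s : CompositionSeries (Submodule Λ M), s.head = ⊥ ∧ s.last = ⊤ then
    h.choose.length else 0

/-- A Gabriel–Roiter chain ending at `M`: a finite set of submodules of `M`, totally ordered
by inclusion (hence a chain `M₁ ⊂ M₂ ⊂ ⋯ ⊂ M_t` with strict inclusions), containing
`M_t = M` itself (the top submodule), all of whose members are indecomposable. -/
def IsGRChain (Λ : Type*) [Ring Λ] {M : Type*} [AddCommGroup M] [Module Λ M]
    (C : Finset (Submodule Λ M)) : Prop :=
  (⊤ : Submodule Λ M) ∈ C ∧ (∀ N₁ ∈ C, ∀ N₂ ∈ C, N₁ ≤ N₂ ∨ N₂ ≤ N₁) ∧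
    ∀ N ∈ C, IsIndecomposableModule Λ ↥N

/-- `S` is the Gabriel–Roiter measure `μ(M)` of `M`: `S` is the set `{ℓ(M₁), …, ℓ(M_t)}`
of composition lengths along some Gabriel–Roiter chain ending at `M`, and is
lexicographically greatest among all such sets. -/
def IsGRMeasureOf (Λ : Type*) [Ring Λ] (M : Type*) [AddCommGroup M] [Module Λ M]
    (S : Finset ℕ) : Prop :=
  (∃ C : Finset (Submodule Λ M), IsGRChain Λ C ∧
      C.image (fun N : Submodule Λ M => compLength Λ ↥N) = S) ∧
  ∀ C : Finset (Submodule Λ M), IsGRChain Λ C →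
      lexLe (C.image (fun N : Submodule Λ M => compLength Λ ↥N)) S

theorem lexLe_of_subset {A B : Finset ℕ} (h : A ⊆ B) : lexLe A B := by
  simp [lexLe, Finset.sdiff_eq_empty_iff_subset.mpr h]

theorem lexLt_iff {A B : Finset ℕ} :
    lexLt A B ↔ ∃ d ∈ B, d ∉ A ∧ ∀ e < d, e ∈ A ↔ e ∈ B := by
  constructor
  · rintro ⟨hle, hne⟩
    have hBA : (B \ A).Nonempty := by
      by_contra! h
      have h' : (A \ B).min = ⊤ := by simpa [lexLe, h] using hle
      rw [Finset.min_eq_top, Finset.sdiff_eq_empty_iff_subset] at h'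
      exact hne (h'.antisymm (Finset.sdiff_eq_empty_iff_subset.mp h))
    obtain ⟨d, hd⟩ := Finset.min_of_nonempty hBA
    have hdm := Finset.mem_of_min hd
    rw [Finset.mem_sdiff] at hdm
    refine ⟨d, hdm.1, hdm.2, fun e he => ⟨fun heA => ?_, fun heB => ?_⟩⟩
    · by_contra heB
      have h1 : (A \ B).min ≤ e := Finset.min_le (by simp [heA, heB])
      have h2 : (d : WithTop ℕ) ≤ e := hd.ge.trans (hle.trans h1)
      exact absurd (WithTop.coe_le_coe.mp h2) (by lia)
    · by_contra heA
      have h1 : (B \ A).min ≤ e := Finset.min_le (by simp [heA, heB])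
      exact absurd (WithTop.coe_le_coe.mp (hd ▸ h1)) (by lia)
  · rintro ⟨d, hdB, hdA, h⟩
    refine ⟨?_, fun hAB => hdA (hAB ▸ hdB)⟩
    have h1 : (B \ A).min ≤ d := Finset.min_le (by simp [hdA, hdB])
    refine h1.trans (Finset.le_min fun e he => WithTop.coe_le_coe.mpr ?_)
    rw [Finset.mem_sdiff] at he
    by_contra! hlt
    exact he.2 ((h e hlt).mp he.1)

theorem lexLt_trans {A B C : Finset ℕ} (hAB : lexLt A B) (hBC : lexLt B C) : lexLt A C := by
  rw [lexLt_iff] at *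
  obtain ⟨d, hdB, hdA, hd⟩ := hAB
  obtain ⟨e, heC, heB, he⟩ := hBC
  rcases lt_trichotomy d e with h | rfl | h
  · exact ⟨d, (he d h).mp hdB, hdA, fun i hi => (hd i hi).trans (he i (hi.trans h))⟩
  · exact absurd hdB heB
  · exact ⟨e, heC, fun h' => heB ((hd e h).mp h'),
      fun i hi => (hd i (hi.trans h)).trans (he i hi)⟩

theorem lexLt_of_lexLt_of_lexLe {A B C : Finset ℕ} (hAB : lexLt A B) (hBC : lexLe B C) :
    lexLt A C := by
  by_cases h : B = C
  · exact h ▸ hAB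
  · exact lexLt_trans hAB ⟨hBC, h⟩

theorem lexLe_trans_s11 {A B C : Finset ℕ} (hAB : lexLe A B) (hBC : lexLe B C) : lexLe A C := by
  by_cases h : A = B
  · exact h ▸ hBC
  · exact (lexLt_of_lexLt_of_lexLe ⟨hAB, h⟩ hBC).1

/-- Adjoining to the smaller set an element exceeding all elements of the larger one preserves
the strict lexicographical order. -/
theorem lexLt_insert_of_forall_lt {A B : Finset ℕ} {a : ℕ} (hAB : lexLt A B)
    (ha : ∀ b ∈ B, b < a) : lexLt (insert a A) B := by
  rw [lexLt_iff] at *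
  obtain ⟨d, hdB, hdA, hd⟩ := hAB
  have hda := ha d hdB
  refine ⟨d, hdB, by simp [hdA, hda.ne], fun e he => ?_⟩
  rw [Finset.mem_insert, ← hd e he]
  exact or_iff_right (by lia)

theorem lexLt_insert_self {A : Finset ℕ} {a : ℕ} (ha : a ∉ A) : lexLt A (insert a A) :=
  ⟨lexLe_of_subset (Finset.subset_insert a A), fun h => ha (h ▸ Finset.mem_insert_self a A)⟩

section Modules

universe u v

variable {Λ : Type v} [Ring Λ] {M N : Type u} [AddCommGroup M] [Module Λ M]
  [AddCommGroup N] [Module Λ N]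

theorem IsIndecomposableModule.of_linearEquiv (h : IsIndecomposableModule Λ M) (e : M ≃ₗ[Λ] N) :
    IsIndecomposableModule Λ N := by
  have := h.1
  refine ⟨e.symm.toEquiv.nontrivial, fun A B hAB => ?_⟩
  let o := Submodule.orderIsoMapComap e.symm
  have := h.2 (o A) (o B) (hAB.map o)
  simpa [map_eq_bot_iff] using this

section Length

variable [IsNoetherian Λ M] [IsArtinian Λ M]

theorem coe_compLength : (compLength Λ M : ℕ∞) = Module.length Λ M := by
  have h := exists_compositionSeries_of_isNoetherian_isArtinian Λ M
  rw [compLength, dif_pos h]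
  exact Module.length_compositionSeries _ h.choose_spec.1 h.choose_spec.2

theorem compLength_le_of_injective [IsNoetherian Λ N] [IsArtinian Λ N] {g : M →ₗ[Λ] N}
    (hg : Function.Injective g) : compLength Λ M ≤ compLength Λ N := by
  have := Module.length_le_of_injective g hg
  rwa [← coe_compLength, ← coe_compLength, Nat.cast_le] at this

theorem LinearEquiv.compLength_eq (e : M ≃ₗ[Λ] N) : compLength Λ M = compLength Λ N := by
  have := isNoetherian_of_linearEquiv e
  have := isArtinian_of_linearEquiv e
  exact (compLength_le_of_injective (g := e.toLinearMap) e.injective).antisymm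
    (compLength_le_of_injective (g := e.symm.toLinearMap) e.symm.injective)

theorem compLength_submodule_lt {A : Submodule Λ M} (h : A ≠ ⊤) :
    compLength Λ A < compLength Λ M := by
  have := Submodule.length_lt h
  rwa [← coe_compLength, ← coe_compLength, Nat.cast_lt] at this

theorem compLength_lt_of_surjective_of_not_injective [IsNoetherian Λ N] [IsArtinian Λ N]
    {g : M →ₗ[Λ] N} (hg : Function.Surjective g) (hg' : ¬ Function.Injective g) :
    compLength Λ N < compLength Λ M := by
  have hadd := Module.length_eq_add_of_exact (LinearMap.ker g).subtype g
    (Submodule.subtype_injective _) hg (LinearMap.exact_subtype_ker_map g)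
  rw [← coe_compLength, ← coe_compLength, ← coe_compLength, ← Nat.cast_add, Nat.cast_inj] at hadd
  have hker : Nontrivial (LinearMap.ker g) := by
    rwa [Submodule.nontrivial_iff_ne_bot, ne_eq, LinearMap.ker_eq_bot]
  have hpos := Module.length_pos (R := Λ) (M := LinearMap.ker g)
  rw [← coe_compLength, Nat.cast_pos] at hpos
  lia

theorem surjective_of_injective_of_compLength_le [IsNoetherian Λ N] [IsArtinian Λ N]
    {g : M →ₗ[Λ] N} (hg : Function.Injective g) (h : compLength Λ N ≤ compLength Λ M) :
    Function.Surjective g := by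
  rw [← LinearMap.range_eq_top]
  by_contra hr
  have h1 := compLength_submodule_lt hr
  rw [← (LinearEquiv.ofInjective g hg).compLength_eq] at h1
  lia

end Length

/-- The set of composition lengths of the members of a finite set of submodules. -/
def chainLengths (C : Finset (Submodule Λ M)) : Finset ℕ :=
  C.image fun A : Submodule Λ M => compLength Λ A

theorem mem_chainLengths {C : Finset (Submodule Λ M)} {a : ℕ} :
    a ∈ chainLengths C ↔ ∃ A ∈ C, compLength Λ A = a :=
  Finset.mem_image

theorem chainLengths_le [IsNoetherian Λ M] [IsArtinian Λ M] {C : Finset (Submodule Λ M)} {a : ℕ}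
    (ha : a ∈ chainLengths C) : a ≤ compLength Λ M := by
  obtain ⟨A, -, rfl⟩ := mem_chainLengths.mp ha
  exact compLength_le_of_injective A.injective_subtype

open Classical in
theorem chainLengths_insert_top [IsNoetherian Λ M] [IsArtinian Λ M]
    (C : Finset (Submodule Λ M)) :
    chainLengths (insert ⊤ C) = insert (compLength Λ M) (chainLengths C) := by
  rw [chainLengths, Finset.image_insert, Submodule.topEquiv.compLength_eq]
  rfl

open Classical in
/-- Push a Gabriel–Roiter chain forward along an injection and adjoin the whole target. -/
theorem IsGRChain.exists_of_injective [IsNoetherian Λ M] [IsArtinian Λ M] [IsNoetherian Λ N]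
    [IsArtinian Λ N] {C : Finset (Submodule Λ M)} (hC : IsGRChain Λ C) {g : M →ₗ[Λ] N}
    (hg : Function.Injective g) (hN : IsIndecomposableModule Λ N) :
    ∃ D : Finset (Submodule Λ N), IsGRChain Λ D ∧
      chainLengths D = insert (compLength Λ N) (chainLengths C) := by
  refine ⟨insert ⊤ (C.image (Submodule.map g)), ⟨by simp, ?_, ?_⟩, ?_⟩
  · simp only [Finset.mem_insert, Finset.mem_image]
    rintro _ (rfl | ⟨A, hA, rfl⟩) _ (rfl | ⟨B, hB, rfl⟩)
    · simp
    · simp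
    · simp
    · exact (hC.2.1 A hA B hB).imp (fun h => Submodule.map_mono h) fun h => Submodule.map_mono h
  · simp only [Finset.mem_insert, Finset.mem_image]
    rintro _ (rfl | ⟨A, hA, rfl⟩)
    · exact hN.of_linearEquiv Submodule.topEquiv.symm
    · exact (hC.2.2 A hA).of_linearEquiv (Submodule.equivMapOfInjective g hg A)
  · rw [chainLengths_insert_top, chainLengths, chainLengths, Finset.image_image]
    congr 1
    exact Finset.image_congr fun A _ =>
      (Submodule.equivMapOfInjective g hg A).compLength_eq.symm

open Classical in
/-- A chain of indecomposable submodules whose greatest element is `A` is a Gabriel–Roiter chain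
of `A`. -/
theorem exists_isGRChain_of_forall_le [IsNoetherian Λ M] [IsArtinian Λ M]
    {C : Finset (Submodule Λ M)} {A : Submodule Λ M} (hA : A ∈ C)
    (hmax : ∀ B ∈ C, B ≤ A) (htot : ∀ B₁ ∈ C, ∀ B₂ ∈ C, B₁ ≤ B₂ ∨ B₂ ≤ B₁)
    (hind : ∀ B ∈ C, IsIndecomposableModule Λ B) :
    ∃ D : Finset (Submodule Λ A), IsGRChain Λ D ∧ D.card ≤ C.card ∧
      chainLengths D = chainLengths C := by
  refine ⟨C.image (Submodule.comap A.subtype), ⟨?_, ?_, ?_⟩, Finset.card_image_le, ?_⟩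
  · exact Finset.mem_image.mpr ⟨A, hA, by simp⟩
  · simp only [Finset.mem_image]
    rintro _ ⟨B₁, h₁, rfl⟩ _ ⟨B₂, h₂, rfl⟩
    exact (htot B₁ h₁ B₂ h₂).imp (fun h => Submodule.comap_mono h) fun h => Submodule.comap_mono h
  · simp only [Finset.mem_image]
    rintro _ ⟨B, hB, rfl⟩
    exact (hind B hB).of_linearEquiv (Submodule.comapSubtypeEquivOfLe (hmax B hB)).symm
  · rw [chainLengths, chainLengths, Finset.image_image]
    exact Finset.image_congr fun B hB =>
      (Submodule.comapSubtypeEquivOfLe (hmax B hB)).compLength_eq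

/-- If a homomorphism does not kill `x`, then neither does some homomorphism with larger kernel
and indecomposable image. -/
theorem exists_isIndecomposableModule_range [IsArtinian Λ N] (g : M →ₗ[Λ] N) {x : M}
    (hx : g x ≠ 0) :
    ∃ p : M →ₗ[Λ] N, LinearMap.ker g ≤ LinearMap.ker p ∧ p x ≠ 0 ∧
      IsIndecomposableModule Λ (LinearMap.range p) := by
  let P : Set (M →ₗ[Λ] N) := {p | LinearMap.ker g ≤ LinearMap.ker p ∧ p x ≠ 0}
  obtain ⟨p, ⟨hker, hpx⟩, hmin⟩ := exists_minimalFor_of_wellFoundedLT (· ∈ P)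
    LinearMap.range ⟨g, le_rfl, hx⟩
  refine ⟨p, hker, hpx, ⟨⟨0, p.rangeRestrict x, fun h => hpx (congrArg Subtype.val h).symm⟩, ?_⟩⟩
  have key : ∀ A B : Submodule Λ (LinearMap.range p), ∀ h : IsCompl A B,
      A.projectionOnto B h (p.rangeRestrict x) ≠ 0 → B = ⊥ := by
    intro A B h hAx
    let q : M →ₗ[Λ] N := (LinearMap.range p).subtype ∘ₗ A.subtype ∘ₗ A.projectionOnto B h ∘ₗ
      p.rangeRestrict
    have hq : q ∈ P := by
      refine ⟨fun y hy => ?_, by simpa [q] using hAx⟩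
      have h0 : p.rangeRestrict y = 0 := Subtype.ext (hker hy)
      simp [q, h0]
    have hle : LinearMap.range q ≤ LinearMap.range p := by
      rintro _ ⟨y, rfl⟩
      exact Subtype.property _
    rw [eq_bot_iff]
    intro b hb
    obtain ⟨y, hy⟩ := hmin hq hle b.2
    have hbA : b ∈ A := by
      rw [← show _ = b from Subtype.ext hy]
      exact Subtype.property _
    exact h.disjoint.le_bot ⟨hbA, hb⟩
  intro A B h
  by_cases hA : A.projectionOnto B h (p.rangeRestrict x) = 0
  · refine Or.inl (key B A h.symm fun hB => hpx ?_)
    rw [← LinearMap.mem_ker, Submodule.ker_projectionOnto] at hA hB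
    exact congrArg Subtype.val (show p.rangeRestrict x = 0 from h.disjoint.le_bot ⟨hB, hA⟩)
  · exact Or.inr (key A B h hA)

/-- A jointly injective family of homomorphisms from `M` to indecomposable modules either contains
an injection or strictly increases the lengths of any given Gabriel–Roiter chain. -/
theorem IsGRChain.exists_injective_or_lexLt {M : Type u} [AddCommGroup M] [Module Λ M]
    [IsNoetherian Λ M] [IsArtinian Λ M] {C : Finset (Submodule Λ M)} (hC : IsGRChain Λ C)
    {ι : Type u} (Y : ι → Type u) [∀ i, AddCommGroup (Y i)] [∀ i, Module Λ (Y i)]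
    [∀ i, IsNoetherian Λ (Y i)] [∀ i, IsArtinian Λ (Y i)]
    (hY : ∀ i, IsIndecomposableModule Λ (Y i)) (g : ∀ i, M →ₗ[Λ] Y i)
    (hg : ∀ x ≠ 0, ∃ i, g i x ≠ 0) :
    ∃ i, Function.Injective (g i) ∨
      ∃ D : Finset (Submodule Λ (Y i)), IsGRChain Λ D ∧
        lexLt (chainLengths C) (chainLengths D) := by
  classical
  induction hn : C.card using Nat.strong_induction_on generalizing M ι with
  | _ n ih =>
  subst hn
  by_contra! hcon
  have hM : IsIndecomposableModule Λ M := (hC.2.2 ⊤ hC.1).of_linearEquiv Submodule.topEquiv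
  choose i hi using fun x : {x : M // x ≠ 0} => hg x x.2
  choose p hker hpx hind using fun x => exists_isIndecomposableModule_range (g (i x)) (hi x)
  have hninj : ∀ x, ¬ Function.Injective (p x).rangeRestrict := fun x hx => (hcon (i x)).1 <| by
    rw [← LinearMap.ker_eq_bot, LinearMap.ker_rangeRestrict] at hx
    exact LinearMap.ker_eq_bot.mp (le_bot_iff.mp ((hker x).trans hx.le))
  have hlen : ∀ x, compLength Λ (LinearMap.range (p x)) < compLength Λ M := fun x =>
    compLength_lt_of_surjective_of_not_injective (p x).surjective_rangeRestrict (hninj x)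
  have hinsert : insert (compLength Λ M) (chainLengths (C.erase ⊤)) = chainLengths C := by
    rw [← chainLengths_insert_top, Finset.insert_erase hC.1]
  have hfinal : ∀ (x) (D : Finset (Submodule Λ (LinearMap.range (p x)))), IsGRChain Λ D →
      ¬ lexLt (chainLengths (C.erase ⊤)) (chainLengths D) := by
    intro x D hD hlt
    obtain ⟨E, hE, hEl⟩ := hD.exists_of_injective
      (LinearMap.range (p x)).injective_subtype (hY (i x))
    refine (hcon (i x)).2 E hE (lexLt_of_lexLt_of_lexLe (B := chainLengths D) ?_
      (lexLe_of_subset (hEl ▸ Finset.subset_insert _ _)))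
    rw [← hinsert]
    exact lexLt_insert_of_forall_lt hlt fun b hb => (chainLengths_le hb).trans_lt (hlen x)
  rcases (C.erase ⊤).eq_empty_or_nonempty with hemp | hne
  · have := hM.1
    obtain ⟨x, hx⟩ := exists_ne (0 : M)
    refine hfinal ⟨x, hx⟩ {⊤} ⟨by simp, by simp, ?_⟩ ?_
    · simpa using (hind ⟨x, hx⟩).of_linearEquiv Submodule.topEquiv.symm
    · rw [hemp]
      exact ⟨lexLe_of_subset (by simp [chainLengths]), by simp [chainLengths]⟩
  · obtain ⟨A, hA, hAmax⟩ := (C.erase ⊤).exists_maximal hne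
    have hAC := Finset.mem_erase.mp hA
    have hAind := hC.2.2 A hAC.2
    have htop : ∀ B ∈ C.erase ⊤, B ≤ A := fun B hB =>
      (hC.2.1 B (Finset.mem_of_mem_erase hB) A hAC.2).elim id (hAmax hB)
    obtain ⟨C', hC', hcard, hl⟩ := exists_isGRChain_of_forall_le hA htop
      (fun B₁ h₁ B₂ h₂ => hC.2.1 B₁ (Finset.mem_of_mem_erase h₁) B₂ (Finset.mem_of_mem_erase h₂))
      (fun B hB => hC.2.2 B (Finset.mem_of_mem_erase hB))
    obtain ⟨x, hx | ⟨D, hD, hlt⟩⟩ := ih C'.card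
      (hcard.trans_lt (Finset.card_erase_lt_of_mem hC.1)) hC'
      (fun x : {x : M // x ≠ 0} => LinearMap.range (p x)) hind
      (fun x => (p x).rangeRestrict ∘ₗ A.subtype)
      (fun a ha => ⟨⟨a, by simpa using ha⟩, fun h => hpx _ (congrArg Subtype.val h)⟩) rfl
    · obtain ⟨D, hD, hDl⟩ := hC'.exists_of_injective hx (hind x)
      refine hfinal x D hD ?_
      rw [hDl, ← hl]
      refine lexLt_insert_self fun hmem => ?_
      have hsurj := surjective_of_injective_of_compLength_le hx (chainLengths_le hmem)
      have hcompl : IsCompl A (LinearMap.ker (p x).rangeRestrict) := by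
        constructor
        · rw [Submodule.disjoint_def]
          intro a ha hka
          have : (⟨a, ha⟩ : A) = 0 := hx (hka.trans (map_zero _).symm)
          exact congrArg Subtype.val this
        · rw [codisjoint_iff, eq_top_iff]
          intro y _
          obtain ⟨a, ha⟩ := hsurj ((p x).rangeRestrict y)
          refine Submodule.mem_sup.mpr ⟨a, a.2, y - a, ?_, by simp⟩
          rw [LinearMap.mem_ker, map_sub, sub_eq_zero]
          exact ha.symm
      rcases hM.2 _ _ hcompl with h | h
      · exact (Submodule.nontrivial_iff_ne_bot.mp hAind.1) h
      · exact hninj x (LinearMap.ker_eq_bot.mp h)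
    · exact hfinal x D hD (hl ▸ hlt)

end Modules

/-- (Main property of the Gabriel–Roiter measure, first part) Let `X, Y₁, …, Yₙ` be
indecomposable finite-dimensional `Λ`-modules and let `m` be an index with `μ(Y_m)`
lexicographically maximal among the `μ(Y_i)`. If there is an injective `Λ`-linear map
`f : X → Y₁ ⊕ ⋯ ⊕ Yₙ`, then `μ(X) ≤ μ(Y_m)`. -/
theorem grMeasure_main_property_le (k : Type) [Field k] (Λ : Type) [Ring Λ]
    [Algebra k Λ] [FiniteDimensional k Λ]
    (X : Type) [AddCommGroup X] [Module Λ X] [Module k X] [IsScalarTower k Λ X]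
    [FiniteDimensional k X] (hX : IsIndecomposableModule Λ X)
    (n : ℕ) (Y : Fin n → Type) [∀ i, AddCommGroup (Y i)] [∀ i, Module Λ (Y i)]
    [∀ i, Module k (Y i)] [∀ i, IsScalarTower k Λ (Y i)] [∀ i, FiniteDimensional k (Y i)]
    (hY : ∀ i, IsIndecomposableModule Λ (Y i))
    (S : Finset ℕ) (hS : IsGRMeasureOf Λ X S)
    (T : Fin n → Finset ℕ) (hT : ∀ i, IsGRMeasureOf Λ (Y i) (T i))
    (m : Fin n) (hm : ∀ i, lexLe (T i) (T m))
    (f : X →ₗ[Λ] ∀ i, Y i) (hf : Function.Injective f) :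
    lexLe S (T m) := by
  have : IsNoetherian Λ X := isNoetherian_of_tower k inferInstance
  have : IsArtinian Λ X := isArtinian_of_tower k inferInstance
  have : ∀ i, IsNoetherian Λ (Y i) := fun i => isNoetherian_of_tower k inferInstance
  have : ∀ i, IsArtinian Λ (Y i) := fun i => isArtinian_of_tower k inferInstance
  obtain ⟨⟨C, hC, rfl⟩, -⟩ := hS
  obtain ⟨i, hi | ⟨D, hD, hlt⟩⟩ := hC.exists_injective_or_lexLt Y hY
    (fun i => LinearMap.proj i ∘ₗ f) (fun x hx => by
      by_contra! h
      exact hx (hf (by rw [map_zero]; exact funext h)))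
  · obtain ⟨D, hD, hDl⟩ := hC.exists_of_injective hi (hY i)
    have hsub : chainLengths C ⊆ chainLengths D := hDl ▸ Finset.subset_insert _ _
    exact lexLe_trans_s11 (lexLe_of_subset hsub)
      (lexLe_trans_s11 ((hT i).2 D hD) (hm i))
  · exact lexLe_trans_s11 hlt.1 (lexLe_trans_s11 ((hT i).2 D hD) (hm i))
end
end
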